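/- Let u(x) = (1/16)·₂F₁(3/2,3/2;3;x)·(1-x) + (1/2)·₂F₁(1/2,1/2;2;x) and v(x) = (1/2)·₂F₁(1/2,1/2;2;x) + ₂F₁(1/2,1/2;1;x). Then Δ(x) = v(x)² - 4·u(x)·₂F₁(1/2,1/2;1;x) is strictly increasing on (0,1) with Δ(0) = 0 and Δ(x) → +∞ as x → 1⁻. -/

import Mathlib

open Real Set Filter

noncomputable def poch (a : ℝ) (n : ℕ) : ℝ := ∏ i ∈ Finset.range n, (a + i)

noncomputable def F (a b c x : ℝ) : ℝ :=
  ∑' n : ℕ, poch a n * poch b n / (poch c n * n.factorial) * x ^ n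

noncomputable def u (x : ℝ) : ℝ :=
  (1/16) * F (3/2) (3/2) 3 x * (1 - x) + (1/2) * F (1/2) (1/2) 2 x

noncomputable def v (x : ℝ) : ℝ :=
  (1/2) * F (1/2) (1/2) 2 x + F (1/2) (1/2) 1 x

noncomputable def Δ (x : ℝ) : ℝ := v x ^ 2 - 4 * u x * F (1/2) (1/2) 1 x

/-- squared central binomial ratio -/
noncomputable def ww (n : ℕ) : ℝ := (poch (1/2) n / n.factorial) ^ 2

noncomputable def bb (n : ℕ) : ℝ := ww n / (n + 1)

noncomputable def ee (n : ℕ) : ℝ := ww n * (n - 1/4) / ((n + 1) * (n + 2))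

/-- power series without its constant term -/
noncomputable def HH (c : ℕ → ℝ) (x : ℝ) : ℝ := ∑' n : ℕ, c (n + 1) * x ^ (n + 1)

lemma poch_succ' (a : ℝ) (n : ℕ) : poch a (n + 1) = poch a n * (a + n) := by
  simp [poch, Finset.prod_range_succ]

lemma poch_pos {a : ℝ} (ha : 0 < a) (n : ℕ) : 0 < poch a n := by
  unfold poch
  exact Finset.prod_pos (fun i _ => by positivity)

lemma poch_one (n : ℕ) : poch 1 n = n.factorial := by
  induction n with
  | zero => simp [poch]
  | succ k ih => rw [poch_succ', ih, Nat.factorial_succ]; push_cast; ring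

lemma poch_two (n : ℕ) : poch 2 n = (n + 1) * n.factorial := by
  induction n with
  | zero => simp [poch]
  | succ k ih => rw [poch_succ', ih, Nat.factorial_succ]; push_cast; ring

lemma poch_three (n : ℕ) : poch 3 n = (n + 1) * (n + 2) / 2 * n.factorial := by
  induction n with
  | zero => simp [poch]
  | succ k ih => rw [poch_succ', ih, Nat.factorial_succ]; push_cast; ring

lemma poch_half (n : ℕ) : poch (3/2) n = (2 * n + 1) * poch (1/2) n := by
  induction n with
  | zero => simp [poch]
  | succ k ih => rw [poch_succ', ih, poch_succ']; push_cast; ring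

lemma ww_zero : ww 0 = 1 := by simp [ww, poch]

lemma ww_succ (n : ℕ) : ww (n + 1) = ww n * ((n + 1/2) / (n + 1)) ^ 2 := by
  unfold ww
  rw [poch_succ', Nat.factorial_succ, ← mul_pow]
  congr 1
  have : (n.factorial : ℝ) ≠ 0 := by positivity
  have : (n + 1 : ℝ) ≠ 0 := by positivity
  push_cast
  field_simp
  ring

lemma ww_pos (n : ℕ) : 0 < ww n := by
  unfold ww
  have := poch_pos (a := 1/2) (by norm_num) n
  positivity

lemma ww_le (n : ℕ) : ww n ≤ 1 := by
  induction n with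
  | zero => simp [ww_zero]
  | succ k ih =>
    rw [ww_succ]
    have h : ((k + 1/2 : ℝ) / (k + 1)) ^ 2 ≤ 1 := by
      apply pow_le_one₀ (by positivity)
      rw [div_le_one (by positivity)]
      linarith
    exact mul_le_one₀ ih (by positivity) h

lemma ww_ge (n : ℕ) : 1 / (4 * (n + 1 : ℝ)) ≤ ww (n + 1) := by
  induction n with
  | zero => rw [ww_succ, ww_zero]; norm_num
  | succ k ih =>
    rw [ww_succ]
    refine le_trans ?_ (mul_le_mul_of_nonneg_right ih (by positivity))
    push_cast
    rw [div_pow, div_mul_div_comm, div_le_div_iff₀ (by positivity) (by positivity)]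
    have : (0 : ℝ) ≤ k := by positivity
    nlinarith [sq_nonneg ((k : ℝ) + 1), mul_nonneg this this]

lemma summ {c : ℕ → ℝ} (h0 : ∀ n, 0 ≤ c (n + 1)) (h1 : ∀ n, c (n + 1) ≤ 1) {x : ℝ}
    (hx0 : 0 ≤ x) (hx1 : x < 1) : Summable (fun n => c (n + 1) * x ^ (n + 1)) := by
  have hg : Summable (fun n : ℕ => x ^ (n + 1)) :=
    (summable_nat_add_iff 1).2 (summable_geometric_of_lt_one hx0 hx1)
  refine Summable.of_nonneg_of_le (fun n => mul_nonneg (h0 n) (by positivity)) (fun n => ?_) hg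
  exact mul_le_of_le_one_left (by positivity) (h1 n)

lemma HH_nonneg {c : ℕ → ℝ} (h0 : ∀ n, 0 ≤ c (n + 1)) {x : ℝ} (hx0 : 0 ≤ x) : 0 ≤ HH c x :=
  tsum_nonneg fun n => mul_nonneg (h0 n) (by positivity)

lemma HH_mono {c : ℕ → ℝ} (h0 : ∀ n, 0 ≤ c (n + 1)) (h1 : ∀ n, c (n + 1) ≤ 1) {x y : ℝ}
    (hx0 : 0 ≤ x) (hxy : x ≤ y) (hy : y < 1) : HH c x ≤ HH c y := by
  refine (summ h0 h1 hx0 (by linarith)).tsum_le_tsum (fun n => ?_) (summ h0 h1 (by linarith) hy)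
  exact mul_le_mul_of_nonneg_left (pow_le_pow_left₀ hx0 hxy _) (h0 n)

lemma HH_strict {c : ℕ → ℝ} (h0 : ∀ n, 0 ≤ c (n + 1)) (h1 : ∀ n, c (n + 1) ≤ 1) (hc : 0 < c 1)
    {x y : ℝ} (hx0 : 0 ≤ x) (hxy : x < y) (hy : y < 1) : HH c x < HH c y := by
  refine Summable.tsum_lt_tsum (i := 0) (fun n => ?_) ?_ (summ h0 h1 hx0 (by linarith))
    (summ h0 h1 (by linarith) hy)
  · exact mul_le_mul_of_nonneg_left (pow_le_pow_left₀ hx0 hxy.le _) (h0 n)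
  · simpa using mul_lt_mul_of_pos_left hxy hc

lemma ww0 (n : ℕ) : 0 ≤ ww (n + 1) := (ww_pos _).le
lemma ww1 (n : ℕ) : ww (n + 1) ≤ 1 := ww_le _
lemma bb0 (n : ℕ) : 0 ≤ bb (n + 1) := by
  unfold bb; have := ww_pos (n + 1); positivity
lemma bb_half (n : ℕ) : bb (n + 1) ≤ ww (n + 1) / 2 := by
  unfold bb
  have := ww_pos (n + 1)
  apply div_le_div_of_nonneg_left this.le (by norm_num)
  push_cast
  have : (0 : ℝ) ≤ n := by positivity
  linarith
lemma bb1 (n : ℕ) : bb (n + 1) ≤ 1 := by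
  have := bb_half n; have := ww1 n; have := ww0 n; linarith
lemma ee0 (n : ℕ) : 0 ≤ ee (n + 1) := by
  unfold ee
  have h := ww_pos (n + 1)
  have h2 : (0 : ℝ) ≤ ((n + 1 : ℕ) : ℝ) - 1/4 := by
    push_cast
    have : (0 : ℝ) ≤ n := by positivity
    linarith
  positivity
lemma ee1 (n : ℕ) : ee (n + 1) ≤ 1 := by
  unfold ee
  have h := ww_pos (n + 1)
  have h1 := ww1 n
  have hn : (0 : ℝ) ≤ n := by positivity
  rw [div_le_one (by positivity)]
  push_cast
  have : ww (n + 1) * ((n : ℝ) + 1 - 1/4) ≤ 1 * ((n : ℝ) + 1 - 1/4) :=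
    mul_le_mul_of_nonneg_right h1 (by linarith)
  nlinarith

noncomputable def qq (n : ℕ) : ℝ := 3 / 4 * ww n - bb n / 2
noncomputable def pp (n : ℕ) : ℝ := ww n - bb n / 2

lemma qq_ge (n : ℕ) : ww (n + 1) / 2 ≤ qq (n + 1) := by
  unfold qq; have := bb_half n; linarith
lemma qq0 (n : ℕ) : 0 ≤ qq (n + 1) := by
  have := qq_ge n; have := ww0 n; linarith
lemma qq1 (n : ℕ) : qq (n + 1) ≤ 1 := by
  unfold qq; have := bb0 n; have := ww1 n; linarith
lemma pp0 (n : ℕ) : 0 ≤ pp (n + 1) := by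
  unfold pp; have := bb_half n; have := ww0 n; linarith
lemma pp1 (n : ℕ) : pp (n + 1) ≤ 1 := by
  unfold pp; have := bb0 n; have := ww1 n; linarith

lemma HH_lin (s t : ℝ) {x : ℝ} (hx0 : 0 ≤ x) (hx1 : x < 1) :
    HH (fun n => s * ww n + t * bb n) x = s * HH ww x + t * HH bb x := by
  unfold HH
  rw [← tsum_mul_left, ← tsum_mul_left, ← Summable.tsum_add]
  · exact tsum_congr fun n => by ring
  · exact (summ ww0 ww1 hx0 hx1).mul_left _
  · exact (summ bb0 bb1 hx0 hx1).mul_left _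

lemma F_A {x : ℝ} (hx0 : 0 ≤ x) (hx1 : x < 1) : F (1/2) (1/2) 1 x = 1 + HH ww x := by
  have h : F (1/2) (1/2) 1 x = ∑' n, ww n * x ^ n := by
    unfold F ww
    refine tsum_congr fun n => ?_
    rw [poch_one]; ring
  rw [h, Summable.tsum_eq_zero_add ((summable_nat_add_iff (f := fun n => ww n * x ^ n) 1).1
    (summ ww0 ww1 hx0 hx1))]
  simp [ww_zero, HH]

lemma F_B {x : ℝ} (hx0 : 0 ≤ x) (hx1 : x < 1) : F (1/2) (1/2) 2 x = 1 + HH bb x := by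
  have h : F (1/2) (1/2) 2 x = ∑' n, bb n * x ^ n := by
    unfold F bb ww
    refine tsum_congr fun n => ?_
    rw [poch_two]; field_simp
  rw [h, Summable.tsum_eq_zero_add ((summable_nat_add_iff (f := fun n => bb n * x ^ n) 1).1
    (summ bb0 bb1 hx0 hx1))]
  simp [bb, ww_zero, HH]

/-- the coefficients n * b_n -/
noncomputable def gg (n : ℕ) : ℝ := n * bb n

lemma gg0 (n : ℕ) : 0 ≤ gg (n + 1) := by
  unfold gg; have := bb0 n; positivity
lemma gg1 (n : ℕ) : gg (n + 1) ≤ 1 := by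
  unfold gg bb
  have := ww1 n
  rw [mul_div_assoc', div_le_one (by positivity)]
  have : ((n + 1 : ℕ) : ℝ) * ww (n + 1) ≤ ((n + 1 : ℕ) : ℝ) * 1 :=
    mul_le_mul_of_nonneg_left this (by positivity)
  linarith

lemma gg_step (n : ℕ) : gg (n + 1) = gg n - ee n := by
  unfold gg bb ee
  rw [ww_succ]
  have h1 : (n + 1 : ℝ) ≠ 0 := by positivity
  have h2 : (n + 2 : ℝ) ≠ 0 := by positivity
  have h3 : (n + 1 + 1 : ℝ) ≠ 0 := by positivity
  push_cast
  field_simp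
  ring

lemma F_E {x : ℝ} (hx0 : 0 ≤ x) (hx1 : x < 1) :
    F (3/2) (3/2) 3 x * (1 - x) = 8 * (1/8 - HH ee x) := by
  have h : F (3/2) (3/2) 3 x = 8 * ∑' n, gg (n + 1) * x ^ n := by
    unfold F
    rw [← tsum_mul_left]
    refine tsum_congr fun n => ?_
    rw [poch_three, poch_half]
    unfold gg bb
    rw [ww_succ]
    unfold ww
    have h1 : (n + 1 : ℝ) ≠ 0 := by positivity
    have h2 : (n + 2 : ℝ) ≠ 0 := by positivity
    have h3 : (n + 1 + 1 : ℝ) ≠ 0 := by positivity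
    have h4 : (n.factorial : ℝ) ≠ 0 := by positivity
    push_cast
    field_simp
    ring
  have hs1 : Summable (fun n => gg (n + 1 + 1) * x ^ (n + 1)) :=
    summ (c := fun n => gg (n + 1)) (fun n => gg0 _) (fun n => gg1 _) hx0 hx1
  have hs : Summable (fun n => gg (n + 1) * x ^ n) :=
    (summable_nat_add_iff (f := fun n => gg (n + 1) * x ^ n) 1).1 hs1
  have hg := summ gg0 gg1 hx0 hx1
  have he := summ ee0 ee1 hx0 hx1
  have hx : (∑' n, gg (n + 1) * x ^ n) * x = HH gg x := by
    unfold HH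
    rw [← tsum_mul_right]
    exact tsum_congr fun n => by ring
  have h2 : ∑' n, gg (n + 1) * x ^ n = 1/8 + (HH gg x - HH ee x) := by
    rw [hs.tsum_eq_zero_add]
    congr 1
    · rw [gg_step]; simp [gg, ee, ww_zero]; norm_num
    · unfold HH
      rw [← hg.tsum_sub he]
      exact tsum_congr fun n => by rw [gg_step (n + 1)]; ring
  rw [h]
  linear_combination 8 * h2 - 8 * hx

lemma Delta_eq {x : ℝ} (hx0 : 0 ≤ x) (hx1 : x < 1) :
    Δ x = HH qq x + HH pp x ^ 2 + 2 * (1 + HH ww x) * HH ee x := by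
  have hq : HH qq x = 3/4 * HH ww x + (-1/2) * HH bb x := by
    rw [← HH_lin _ _ hx0 hx1]; congr 1; funext n; unfold qq; ring
  have hp : HH pp x = 1 * HH ww x + (-1/2) * HH bb x := by
    rw [← HH_lin _ _ hx0 hx1]; congr 1; funext n; unfold pp; ring
  have hu : u x = (1/16) * (F (3/2) (3/2) 3 x * (1 - x)) + (1/2) * F (1/2) (1/2) 2 x := by
    unfold u; ring
  unfold Δ
  rw [hu]
  unfold v
  rw [F_E hx0 hx1, F_A hx0 hx1, F_B hx0 hx1, hq, hp]
  ring

lemma Delta_ge {x : ℝ} (hx0 : 0 ≤ x) (hx1 : x < 1) : -Real.log (1 - x) / 8 ≤ Δ x := by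
  have h1 : -Real.log (1 - x) / 8 ≤ HH qq x := by
    have hl := (Real.hasSum_pow_div_log_of_abs_lt_one (x := x) (by rwa [abs_of_nonneg hx0])).div_const 8
    rw [← hl.tsum_eq]
    refine hl.summable.tsum_le_tsum (fun n => ?_) (summ qq0 qq1 hx0 hx1)
    have h := qq_ge n
    have h' := ww_ge n
    have : 1 / (8 * (n + 1 : ℝ)) ≤ qq (n + 1) := by
      have e : 1 / (8 * (n + 1 : ℝ)) = 1 / (4 * (n + 1 : ℝ)) / 2 := by field_simp; norm_num
      linarith
    calc x ^ (n + 1) / (n + 1) / 8 = 1 / (8 * (n + 1 : ℝ)) * x ^ (n + 1) := by field_simp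
      _ ≤ _ := mul_le_mul_of_nonneg_right this (by positivity)
  rw [Delta_eq hx0 hx1]
  have := HH_nonneg ww0 hx0
  have := HH_nonneg ee0 hx0
  have : 0 ≤ 2 * (1 + HH ww x) * HH ee x := by positivity
  nlinarith [sq_nonneg (HH pp x)]

theorem stmt10 :
    StrictMonoOn Δ (Ioo 0 1) ∧ Δ 0 = 0 ∧
    Tendsto Δ (nhdsWithin 1 (Ioo 0 1)) atTop := by
  refine ⟨?_, ?_, ?_⟩
  · intro x hx y hy hxy
    have hx0 := hx.1.le
    rw [Delta_eq hx0 hx.2, Delta_eq hy.1.le hy.2]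
    have hq : HH qq x < HH qq y :=
      HH_strict qq0 qq1 (by have := qq_ge 0; have := ww_pos 1; simp at *; linarith) hx0 hxy hy.2
    have hp := HH_mono pp0 pp1 hx0 hxy.le hy.2
    have hw := HH_mono ww0 ww1 hx0 hxy.le hy.2
    have he := HH_mono ee0 ee1 hx0 hxy.le hy.2
    have hp0 := HH_nonneg pp0 hx0
    have hw0 := HH_nonneg ww0 hx0
    have he0 := HH_nonneg ee0 hx0
    have h2 : HH pp x ^ 2 ≤ HH pp y ^ 2 := pow_le_pow_left₀ hp0 hp 2
    have h3 : 2 * (1 + HH ww x) * HH ee x ≤ 2 * (1 + HH ww y) * HH ee y :=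
      mul_le_mul (by linarith) he he0 (by linarith)
    linarith
  · rw [Delta_eq le_rfl one_pos]
    simp [HH]
  · have ht : Tendsto (fun x : ℝ => 1 - x) (nhdsWithin 1 (Ioo 0 1)) (nhdsWithin 0 (Ioi 0)) := by
      apply tendsto_nhdsWithin_of_tendsto_nhds_of_eventually_within
      · have : Tendsto (fun x : ℝ => 1 - x) (nhds 1) (nhds (1 - 1)) :=
          (continuous_const.sub continuous_id).tendsto 1
        rw [sub_self] at this
        exact this.mono_left nhdsWithin_le_nhds
      · filter_upwards [self_mem_nhdsWithin] with x hx
        exact sub_pos.2 hx.2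
    have hl : Tendsto (fun x : ℝ => -Real.log (1 - x) / 8) (nhdsWithin 1 (Ioo 0 1)) atTop :=
      (tendsto_neg_atBot_atTop.comp (Real.tendsto_log_nhdsGT_zero.comp ht)).atTop_div_const
        (by norm_num)
    refine tendsto_atTop_mono' _ ?_ hl
    filter_upwards [self_mem_nhdsWithin] with x hx
    exact Delta_ge hx.1.le hx.2
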